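/- For every 0 ≤ k ≤ N−2 and 1 ≤ j ≤ k+2: the entries (U_k)_{1,j} for 1 ≤ j ≤ k+1 lie in R (contain no y), and (U_{k+1})_{1,j} = σ((U_k)_{1,j−1}) + I_{1,t+k} · (U_k)_{1,j}, where (U_k)_{1,0} := 0 and U_0 is the identity matrix. -/

import Mathlib

/-- The two arrow symbols `↙` (`sw`) and `↘` (`se`). -/
inductive Arrow : Type
  | sw  -- ↙ : multiply by `I_{1,t+r}`
  | se  -- ↘ : apply the shift `σ`
deriving DecidableEq

instance instFintypeArrow : Fintype Arrow where
  elems := {Arrow.sw, Arrow.se}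
  complete := by intro x; cases x <;> simp

/-- The ring `R = ℂ[I_{n,s} : n, s ∈ ℤ]`, realized as multivariate polynomials in the
variables `(n, s) : ℤ × ℤ` (the variable `(n, s)` is the indeterminate `I_{n,s}`). -/
abbrev TodaRing : Type := MvPolynomial (ℤ × ℤ) ℂ

/-- The shift homomorphism `σ : R → R`, `σ(I_{n,s}) = I_{n+1,s}`. -/
noncomputable def shiftσ : TodaRing →ₐ[ℂ] TodaRing :=
  MvPolynomial.rename (fun p => (p.1 + 1, p.2))

/-- Auxiliary bracket, recursing on the *last* element of the sequence: the argument list is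
the sequence `(a_1, …, a_r)` in reverse order. -/
noncomputable def bracketAux (t : ℤ) : List Arrow → TodaRing
  | [] => 1
  | Arrow.sw :: rest => MvPolynomial.X ((1 : ℤ), t + rest.length) * bracketAux t rest
  | Arrow.se :: rest => shiftσ (bracketAux t rest)

/-- The bracket `{(a_1, …, a_r)} ∈ R`, defined by `{()} = 1`,
`{(a_1, …, a_r, ↙)} = I_{1,t+r} · {(a_1, …, a_r)}` and
`{(a_1, …, a_r, ↘)} = σ({(a_1, …, a_r)})`. -/
noncomputable def bracket (t : ℤ) (a : List Arrow) : TodaRing :=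
  bracketAux t a.reverse

/-- `u_j^{(k)}`: the sum of `{a}` over all sequences `a ∈ {↙,↘}^k` containing exactly
`j - 1` symbols `↘`. -/
noncomputable def uSum (t : ℤ) (j k : ℕ) : TodaRing :=
  ∑ a ∈ Finset.univ.filter
      (fun a : Fin k → Arrow => (List.ofFn a).count Arrow.se = j - 1),
    bracket t (List.ofFn a)

/-- The matrix `R_s(y)` over `R[y]`: diagonal `I_{n,s}`, superdiagonal `1`, corner
`(N,1)`-entry `y`. -/
noncomputable def RmatP (N : ℕ) (s : ℤ) :
    Matrix (Fin N) (Fin N) (Polynomial TodaRing) :=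
  fun i j =>
    if (i : ℕ) = (j : ℕ) then Polynomial.C (MvPolynomial.X ((((i : ℕ) : ℤ) + 1, s)))
    else if (j : ℕ) = (i : ℕ) + 1 then 1
    else if (i : ℕ) = N - 1 ∧ (j : ℕ) = 0 then Polynomial.X
    else 0

/-- `U_k = R_{t+k-1}(y) ⋯ R_{t+1}(y) R_t(y)`, with `U_0` the identity matrix. -/
noncomputable def Umat (N : ℕ) (t : ℤ) : ℕ → Matrix (Fin N) (Fin N) (Polynomial TodaRing)
  | 0 => 1
  | k + 1 => RmatP N (t + k) * Umat N t k

/-- The `y`-free entries of `U_k`, indexed by natural numbers (zero-based). -/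
noncomputable def fEntry (t : ℤ) : ℕ → ℕ → ℕ → TodaRing
  | 0, i, j => if i = j then 1 else 0
  | k + 1, i, j =>
      MvPolynomial.X (((i : ℕ) : ℤ) + 1, t + k) * fEntry t k i j + fEntry t k (i + 1) j

theorem fEntry_shift (t : ℤ) (k i j : ℕ) :
    fEntry t k (i + 1) (j + 1) = shiftσ (fEntry t k i j) := by
  induction k generalizing i with
  | zero =>
    simp only [fEntry, Nat.add_right_cancel_iff]
    split_ifs <;> simp
  | succ k ih =>
    simp only [fEntry, map_add, map_mul, ih]
    simp [shiftσ]

theorem fEntry_succ_zero (t : ℤ) (k i : ℕ) : fEntry t k (i + 1) 0 = 0 := by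
  induction k generalizing i with
  | zero => simp [fEntry]
  | succ k ih => simp [fEntry, ih]

theorem Umat_eq_fEntry (N : ℕ) (t : ℤ) (k i j : ℕ) (hi : i < N) (hj : j < N)
    (h : i + k ≤ N - 1) :
    Umat N t k ⟨i, hi⟩ ⟨j, hj⟩ = Polynomial.C (fEntry t k i j) := by
  induction k generalizing i with
  | zero =>
    simp only [Umat, fEntry, Matrix.one_apply, Fin.mk.injEq]
    split_ifs <;> simp
  | succ k ih =>
    have hi1 : i + 1 < N := by omega
    have hne : (⟨i, hi⟩ : Fin N) ≠ ⟨i + 1, hi1⟩ := by simp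
    rw [Umat, Matrix.mul_apply, Fintype.sum_eq_add _ _ hne, ih i hi (by omega),
      ih (i + 1) hi1 (by omega)]
    · simp [RmatP, fEntry]
    · rintro ⟨l, hl⟩ ⟨h1, h2⟩
      simp only [ne_eq, Fin.mk.injEq] at h1 h2
      have h3 : RmatP N (t + k) ⟨i, hi⟩ ⟨l, hl⟩ = 0 := by
        simp only [RmatP]
        rw [if_neg (by omega), if_neg (by omega), if_neg (by omega)]
      rw [h3, zero_mul]

/-- equation (A.1) of the appendix: for `0 ≤ k ≤ N-2`, the entries
`(U_k)_{1,j}` with `1 ≤ j ≤ k+1` lie in `R` (contain no `y`), and for `1 ≤ j ≤ k+2` one has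
`(U_{k+1})_{1,j} = σ((U_k)_{1,j-1}) + I_{1,t+k} (U_k)_{1,j}`, with `(U_k)_{1,0} := 0`
(1-based indices; `σ` is extended to `R[y]` coefficientwise). -/
theorem Umat_first_row_recursion (N : ℕ) (hN : 2 ≤ N) (t : ℤ) (k : ℕ) (hk : k ≤ N - 2) :
    (∀ j : ℕ, ∀ _hj1 : 1 ≤ j, ∀ _hj2 : j ≤ k + 1,
      ∃ p : TodaRing, Umat N t k ⟨0, by omega⟩ ⟨j - 1, by omega⟩ = Polynomial.C p) ∧
    (∀ j : ℕ, ∀ _hj1 : 1 ≤ j, ∀ _hj2 : j ≤ k + 2,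
      Umat N t (k + 1) ⟨0, by omega⟩ ⟨j - 1, by omega⟩ =
        (if 2 ≤ j then
            Polynomial.map shiftσ.toRingHom (Umat N t k ⟨0, by omega⟩ ⟨j - 2, by omega⟩)
          else 0) +
        Polynomial.C (MvPolynomial.X ((1 : ℤ), t + k)) *
          Umat N t k ⟨0, by omega⟩ ⟨j - 1, by omega⟩) := by
  refine ⟨fun j h1 h2 => ⟨_, Umat_eq_fEntry N t k 0 (j - 1) _ _ (by omega)⟩, fun j h1 h2 => ?_⟩
  rw [Umat_eq_fEntry N t (k + 1) 0 (j - 1) _ _ (by omega),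
    Umat_eq_fEntry N t k 0 (j - 1) _ _ (by omega),
    Umat_eq_fEntry N t k 0 (j - 2) _ _ (by omega)]
  obtain ⟨j, rfl⟩ : ∃ m, j = m + 1 := ⟨j - 1, by omega⟩
  cases j with
  | zero => simp [fEntry, fEntry_succ_zero]
  | succ j =>
    have e : fEntry t (k + 1) 0 (j + 1) =
        shiftσ (fEntry t k 0 j) + MvPolynomial.X ((1 : ℤ), t + k) * fEntry t k 0 (j + 1) := by
      rw [fEntry, fEntry_shift, add_comm]; simp
    rw [if_pos (by omega), Polynomial.map_C, ← Polynomial.C_mul, ← Polynomial.C_add]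
    exact congrArg Polynomial.C e
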